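/- arXiv:1501.07246 — 2 statements merged into one kernel-verified Lean document; each statement's English description precedes it below -/
import Mathlib

section
/- Let D ⊂ ℝ² be open, u ∈ C¹(D), and let K, M : D → ℝ be continuous. Suppose ∫_D (K·v + M·(v_x + 2u·v_t + 2v·u_t)) dx dt = 0 for all v ∈ C_c^∞(D). Then the same identity holds for every compactly supported continuous v : D → ℝ for which v_x + 2u·v_t exists and is continuous. -/
open MeasureTheory Filter Topology Metric Set
open scoped Convolution

theorem tendsto_setIntegral_of_dominated_on_compact {D N : Set (ℝ × ℝ)} (hD : IsOpen D)
    (hN : IsCompact N) (hND : N ⊆ D) {K M ut : ℝ × ℝ → ℝ} (hK : ContinuousOn K D)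
    (hM : ContinuousOn M D) (hut : ContinuousOn ut D) {f w : ℕ → ℝ × ℝ → ℝ}
    {f₀ w₀ : ℝ × ℝ → ℝ} {B : ℝ}
    (hf : ∀ n, AEStronglyMeasurable (f n) (volume.restrict D))
    (hw : ∀ n, AEStronglyMeasurable (w n) (volume.restrict D))
    (hfB : ∀ᶠ n in atTop, ∀ p, |f n p| ≤ B)
    (hwB : ∀ᶠ n in atTop, ∀ᵐ p ∂volume.restrict D, |w n p| ≤ B)
    (hf0 : ∀ᶠ n in atTop, ∀ p ∉ N, f n p = 0)
    (hw0 : ∀ᶠ n in atTop, ∀ p ∉ N, w n p = 0)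
    (hflim : ∀ p, Tendsto (fun n => f n p) atTop (𝓝 (f₀ p)))
    (hwlim : ∀ᵐ p ∂volume.restrict D, Tendsto (fun n => w n p) atTop (𝓝 (w₀ p))) :
    Tendsto (fun n => ∫ p in D, (K p * f n p + M p * (w n p + 2 * f n p * ut p))) atTop
      (𝓝 (∫ p in D, (K p * f₀ p + M p * (w₀ p + 2 * f₀ p * ut p)))) := by
  obtain ⟨CK, hCK⟩ := hN.exists_bound_of_continuousOn (hK.mono hND)
  obtain ⟨CM, hCM⟩ := hN.exists_bound_of_continuousOn (hM.mono hND)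
  obtain ⟨CU, hCU⟩ := hN.exists_bound_of_continuousOn (hut.mono hND)
  have hKm := hK.aestronglyMeasurable (μ := volume) hD.measurableSet
  have hMm := hM.aestronglyMeasurable (μ := volume) hD.measurableSet
  have hUm := hut.aestronglyMeasurable (μ := volume) hD.measurableSet
  refine tendsto_integral_filter_of_dominated_convergence
    (N.indicator fun _ => CK * B + CM * (B + 2 * B * CU)) ?_ ?_ ?_ ?_
  · exact Eventually.of_forall fun n =>
      (hKm.mul (hf n)).add (hMm.mul ((hw n).add (((hf n).const_mul 2).mul hUm)))
  · filter_upwards [hfB, hwB, hf0, hw0] with n h1 h2 h3 h4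
    filter_upwards [h2] with p hp
    by_cases hpN : p ∈ N
    · have a1 := hCK p hpN
      have a2 := hCM p hpN
      have a3 := hCU p hpN
      have a4 := h1 p
      have hB : 0 ≤ B := (abs_nonneg _).trans a4
      have hCK0 : 0 ≤ CK := (norm_nonneg _).trans a1
      have hCM0 : 0 ≤ CM := (norm_nonneg _).trans a2
      rw [indicator_of_mem hpN]
      simp only [Real.norm_eq_abs] at *
      calc |K p * f n p + M p * (w n p + 2 * f n p * ut p)|
          ≤ |K p * f n p| + |M p * (w n p + 2 * f n p * ut p)| := abs_add_le _ _
        _ ≤ |K p * f n p| + |M p| * (|w n p| + |2 * f n p * ut p|) := by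
            rw [abs_mul (M p)]; gcongr; exact abs_add_le _ _
        _ = |K p| * |f n p| + |M p| * (|w n p| + 2 * |f n p| * |ut p|) := by
            simp [abs_mul]
        _ ≤ _ := by gcongr
    · simp [indicator_of_notMem hpN, h3 p hpN, h4 p hpN]
  · rw [integrable_indicator_iff hN.measurableSet]
    exact (integrableOn_const (by
      exact ((Measure.restrict_apply_le D N).trans_lt hN.measure_lt_top).ne))
  · filter_upwards [hwlim] with p hp
    exact ((hflim p).const_mul _).add
      ((hp.add (((hflim p).const_mul 2).mul_const _)).const_mul _)

theorem LipschitzWith.hasFDerivAt_convolution {f ρ : ℝ × ℝ → ℝ} {C : NNReal}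
    (hf : LipschitzWith C f) (hρ : Continuous ρ) (hρc : HasCompactSupport ρ) (x : ℝ × ℝ) :
    HasFDerivAt (ρ ⋆[ContinuousLinearMap.lsmul ℝ ℝ, volume] f)
      ((ρ ⋆[ContinuousLinearMap.lsmul ℝ ℝ, volume] fderiv ℝ f) x) x := by
  have hint : Integrable ρ := hρ.integrable_of_hasCompactSupport hρc
  have hmeas : Measurable (fderiv ℝ f) := measurable_fderiv ℝ f
  refine (hasFDerivAt_integral_of_dominated_loc_of_lip
    (F := fun y t => ρ t • f (y - t)) (F' := fun t => ρ t • fderiv ℝ f (x - t))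
    (bound := fun t => ‖ρ t‖ * C) (s := univ) (μ := volume) univ_mem ?_ ?_ ?_ ?_ ?_ ?_).2
  · refine Eventually.of_forall fun y => Continuous.aestronglyMeasurable ?_
    have := hf.continuous
    fun_prop
  · have := hf.continuous
    refine Continuous.integrable_of_hasCompactSupport (by fun_prop) ?_
    exact hρc.smul_right
  · refine hρ.aestronglyMeasurable.smul ?_
    exact (hmeas.comp (measurable_const.sub measurable_id)).aestronglyMeasurable
  · refine Eventually.of_forall fun t => LipschitzOnWith.of_dist_le_mul fun y _ z _ => ?_
    have := hf.dist_le_mul (y - t) (z - t)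
    rw [dist_sub_right] at this
    simp only [dist_smul₀, Real.coe_nnabs]
    rw [abs_of_nonneg (by positivity), mul_assoc]
    gcongr
  · exact hint.norm.mul_const _
  · have h1 : ∀ᵐ t : ℝ × ℝ, DifferentiableAt ℝ f (x - t) :=
      (Measure.measurePreserving_sub_left volume x).quasiMeasurePreserving.ae
        hf.ae_differentiableAt
    filter_upwards [h1] with t ht
    have h2 : HasFDerivAt (fun y => f (y - t)) (fderiv ℝ f (x - t)) x := by
      have := ht.hasFDerivAt.comp x ((hasFDerivAt_id x).sub_const t)
      simpa [Function.comp_def] using this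
    exact h2.const_smul (ρ t)

theorem setIntegral_eq_zero_of_lipschitzWith
    {D : Set (ℝ × ℝ)} (hD : IsOpen D) {u ut K M : ℝ × ℝ → ℝ}
    (hu : ContinuousOn u D) (hutc : ContinuousOn ut D)
    (hK : ContinuousOn K D) (hM : ContinuousOn M D)
    (h : ∀ v : ℝ × ℝ → ℝ, ContDiff ℝ (⊤ : ℕ∞) v → HasCompactSupport v → tsupport v ⊆ D →
      ∫ p in D, (K p * v p + M p * (fderiv ℝ v p (1, 2 * u p) + 2 * v p * ut p)) = 0)
    {f : ℝ × ℝ → ℝ} {C : NNReal} (hf : LipschitzWith C f) (hfc : HasCompactSupport f)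
    (hfD : tsupport f ⊆ D) :
    ∫ p in D, (K p * f p + M p * (fderiv ℝ f p (1, 2 * u p) + 2 * f p * ut p)) = 0 := by
  obtain ⟨δ, hδ, hδD⟩ := hfc.isCompact.exists_cthickening_subset_open hD hfD
  set N := cthickening δ (tsupport f)
  have hN : IsCompact N := hfc.isCompact.cthickening
  obtain ⟨B, hB⟩ := hfc.exists_bound_of_continuous hf.continuous
  obtain ⟨U, hU⟩ := hN.exists_bound_of_continuousOn (hu.mono hδD)
  have hB0 : 0 ≤ B := (norm_nonneg _).trans (hB 0)
  let φ : ℕ → ContDiffBump (0 : ℝ × ℝ) := fun n =>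
    ⟨1 / ((n : ℝ) + 1), 2 / ((n : ℝ) + 1), by positivity, by gcongr; norm_num⟩
  have hφ : Tendsto (fun n => (φ n).rOut) atTop (𝓝 0) := by
    have := (tendsto_one_div_add_atTop_nhds_zero_nat (𝕜 := ℝ)).const_mul 2
    simpa [φ, div_eq_mul_inv] using this
  let F : ℕ → ℝ × ℝ → ℝ := fun n =>
    (φ n).normed volume ⋆[ContinuousLinearMap.lsmul ℝ ℝ, volume] f
  have hFs : ∀ n, ContDiff ℝ (⊤ : ℕ∞) (F n) := fun n =>
    (φ n).hasCompactSupport_normed.contDiff_convolution_left _ (φ n).contDiff_normed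
      hf.continuous.locallyIntegrable
  have hFd : ∀ n p, fderiv ℝ (F n) p = ((φ n).normed volume
      ⋆[ContinuousLinearMap.lsmul ℝ ℝ, volume] fderiv ℝ f) p := fun n p =>
    (hf.hasFDerivAt_convolution (φ n).continuous_normed (φ n).hasCompactSupport_normed p).fderiv
  have hmeas : Measurable (fderiv ℝ f) := measurable_fderiv ℝ f
  have hnorm : ∀ p, ‖fderiv ℝ f p‖ ≤ C := fun p => norm_fderiv_le_of_lipschitz ℝ hf
  have hFsupp : ∀ᶠ n in atTop, tsupport (F n) ⊆ N := by
    filter_upwards [hφ.eventually (gt_mem_nhds hδ)] with n hn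
    refine closure_minimal ?_ isClosed_cthickening
    intro p hp
    obtain ⟨a, ha, b, hb, rfl⟩ := support_convolution_subset _ hp
    rw [(φ n).support_normed_eq] at ha
    refine mem_cthickening_of_dist_le _ b _ _ (subset_tsupport f hb) ?_
    rw [mem_ball, dist_zero_right] at ha
    simpa [dist_eq_norm] using (ha.trans hn).le
  have hFzero : ∀ᶠ n in atTop,
      ∫ p in D, (K p * F n p + M p * (fderiv ℝ (F n) p (1, 2 * u p) + 2 * F n p * ut p)) = 0 := by
    filter_upwards [hFsupp] with n hn
    exact h _ (hFs n) (hN.of_isClosed_subset (isClosed_tsupport _) hn) (hn.trans hδD)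
  have hFB : ∀ n p, |F n p| ≤ 3 * B := by
    intro n p
    have h1 : dist (F n p) (f p) ≤ 2 * B :=
      (φ n).dist_normed_convolution_le hf.continuous.aestronglyMeasurable fun x _ =>
        (dist_le_norm_add_norm _ _).trans (by linarith [hB x, hB p])
    have h2 := hB p
    rw [Real.dist_eq] at h1
    rw [Real.norm_eq_abs] at h2
    have := abs_add_le (F n p - f p) (f p)
    rw [sub_add_cancel] at this
    linarith
  have hFDB : ∀ n p, ‖fderiv ℝ (F n) p‖ ≤ 3 * C := by
    intro n p
    have h1 : dist (fderiv ℝ (F n) p) (fderiv ℝ f p) ≤ 2 * C := by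
      rw [hFd]
      exact (φ n).dist_normed_convolution_le hmeas.aestronglyMeasurable fun x _ =>
        (dist_le_norm_add_norm _ _).trans (by linarith [hnorm x, hnorm p])
    have h2 := hnorm p
    rw [dist_eq_norm] at h1
    have := norm_add_le (fderiv ℝ (F n) p - fderiv ℝ f p) (fderiv ℝ f p)
    rw [sub_add_cancel] at this
    linarith
  have hFD0 : ∀ᶠ n in atTop, ∀ p ∉ N, fderiv ℝ (F n) p = 0 := by
    filter_upwards [hFsupp] with n hn p hp
    exact fderiv_of_notMem_tsupport ℝ (fun hh => hp (hn hh))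
  have hlim := tendsto_setIntegral_of_dominated_on_compact hD hN hδD hK hM hutc
    (f := F) (w := fun n p => fderiv ℝ (F n) p (1, 2 * u p)) (f₀ := f)
    (w₀ := fun p => fderiv ℝ f p (1, 2 * u p)) (B := max (3 * B) (3 * C * max 1 (2 * U)))
    (fun n => (hFs n).continuous.aestronglyMeasurable)
    (fun n => ?_) (Eventually.of_forall fun n p => (hFB n p).trans (le_max_left _ _))
    ?_ ?_ ?_ ?_ ?_
  · exact tendsto_nhds_unique (hlim.congr' hFzero) tendsto_const_nhds
  · refine ContinuousOn.aestronglyMeasurable ?_ hD.measurableSet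
    exact ((hFs n).continuous_fderiv (by simp)).continuousOn.clm_apply
      (continuousOn_const.prodMk (continuousOn_const.mul hu))
  · filter_upwards [hFD0] with n hn
    refine Eventually.of_forall fun p => ?_
    by_cases hp : p ∈ N
    · refine le_trans ?_ (le_max_right _ _)
      refine ((fderiv ℝ (F n) p).le_opNorm _).trans ?_
      have := hU p hp
      gcongr
      · exact hFDB n p
      · rw [Prod.norm_def]
        simp only [norm_one, norm_mul, Real.norm_ofNat]
        gcongr
    · rw [hn p hp]
      simp [hB0]
  · filter_upwards [hFsupp] with n hn p hp
    exact image_eq_zero_of_notMem_tsupport (fun hh => hp (hn hh))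
  · filter_upwards [hFD0] with n hn p hp
    simp [hn p hp]
  · exact fun p => ContDiffBump.convolution_tendsto_right_of_continuous hφ hf.continuous p
  · refine ae_restrict_of_ae ?_
    have hloc : LocallyIntegrable (fderiv ℝ f) (volume : Measure (ℝ × ℝ)) := by
      refine (locallyIntegrable_const (C : ℝ)).mono hmeas.aestronglyMeasurable ?_
      exact Eventually.of_forall fun p => by simpa using hnorm p
    filter_upwards [ContDiffBump.ae_convolution_tendsto_right_of_locallyIntegrable (K := 2) hφ
      (Eventually.of_forall fun n => by simp [φ, div_eq_mul_inv]) hloc] with p hp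
    simp only [hFd]
    exact ((ContinuousLinearMap.apply ℝ ℝ ((1 : ℝ), 2 * u p)).continuous.tendsto _).comp hp

theorem Prod.sq_norm_le_add_sq (z : ℝ × ℝ) : ‖z‖ ^ 2 ≤ z.1 ^ 2 + z.2 ^ 2 := by
  rw [Prod.norm_def]
  rcases max_cases ‖z.1‖ ‖z.2‖ with ⟨h, _⟩ | ⟨h, _⟩ <;> rw [h, Real.norm_eq_abs, sq_abs] <;>
    nlinarith [sq_nonneg z.1, sq_nonneg z.2]

/-- `f` is the quadratic sup-convolution of `v` with parameter `c`, and `Q p` is a point at which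
the supremum defining `f p` is attained. -/
structure IsSupConvolution (v : ℝ × ℝ → ℝ) (c : ℝ) (f : ℝ × ℝ → ℝ) (Q : ℝ × ℝ → ℝ × ℝ) :
    Prop where
  le : ∀ p q, v q - c * ((p.1 - q.1) ^ 2 + (p.2 - q.2) ^ 2) ≤ f p
  eq : ∀ p, f p = v (Q p) - c * ((p.1 - (Q p).1) ^ 2 + (p.2 - (Q p).2) ^ 2)

theorem exists_isSupConvolution {v : ℝ × ℝ → ℝ} (hv : Continuous v) {B : ℝ}
    (hB : ∀ p, |v p| ≤ B) {c : ℝ} (hc : 0 < c) : ∃ f Q, IsSupConvolution v c f Q := by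
  have key : ∀ p : ℝ × ℝ, ∃ q : ℝ × ℝ, ∀ q' : ℝ × ℝ,
      v q' - c * ((p.1 - q'.1) ^ 2 + (p.2 - q'.2) ^ 2) ≤
        v q - c * ((p.1 - q.1) ^ 2 + (p.2 - q.2) ^ 2) := by
    intro p
    refine Continuous.exists_forall_ge'
      (f := fun q : ℝ × ℝ => v q - c * ((p.1 - q.1) ^ 2 + (p.2 - q.2) ^ 2)) (by fun_prop) p ?_
    filter_upwards [(tendsto_dist_left_cocompact_atTop p).eventually_ge_atTop (2 * B / c + 1)]
      with q hq
    have h1 := Prod.sq_norm_le_add_sq (p - q)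
    rw [← dist_eq_norm] at h1
    have hB0 : 0 ≤ B := (abs_nonneg _).trans (hB p)
    have h0 : 0 ≤ 2 * B / c := by positivity
    have h2 : 2 * B / c ≤ dist p q ^ 2 := by nlinarith
    have h3 : 2 * B ≤ dist p q ^ 2 * c := (div_le_iff₀ hc).1 h2
    have h4 : dist p q ^ 2 * c ≤ ((p - q).1 ^ 2 + (p - q).2 ^ 2) * c := by gcongr
    simp only [Prod.fst_sub, Prod.snd_sub] at h4
    simp only [sub_self]
    linarith [(abs_le.1 (hB p)).1, (abs_le.1 (hB q)).2]
  choose Q hQ using key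
  exact ⟨_, Q, ⟨hQ, fun p => rfl⟩⟩

namespace IsSupConvolution

variable {v f : ℝ × ℝ → ℝ} {Q : ℝ × ℝ → ℝ × ℝ} {B c : ℝ}

theorem self_le (h : IsSupConvolution v c f Q) (p : ℝ × ℝ) : v p ≤ f p := by
  simpa using h.le p p

theorem mul_sq_dist_le (h : IsSupConvolution v c f Q) (hc : 0 < c) (p : ℝ × ℝ) :
    c * dist (Q p) p ^ 2 ≤ v (Q p) - v p := by
  have h1 := Prod.sq_norm_le_add_sq (p - Q p)
  rw [← dist_eq_norm, dist_comm] at h1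
  have h2 := mul_le_mul_of_nonneg_left h1 hc.le
  simp only [Prod.fst_sub, Prod.snd_sub] at h2
  linarith [h.self_le p, h.eq p]

theorem le_apply (h : IsSupConvolution v c f Q) (hc : 0 < c) (p : ℝ × ℝ) : f p ≤ v (Q p) := by
  rw [h.eq p]
  have : 0 ≤ c * ((p.1 - (Q p).1) ^ 2 + (p.2 - (Q p).2) ^ 2) := by positivity
  linarith

theorem abs_le (h : IsSupConvolution v c f Q) (hB : ∀ p, |v p| ≤ B) (hc : 0 < c) (p : ℝ × ℝ) :
    |f p| ≤ B :=
  _root_.abs_le.2 ⟨(_root_.abs_le.1 (hB p)).1.trans (h.self_le p),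
    (h.le_apply hc p).trans (_root_.abs_le.1 (hB _)).2⟩

theorem sub_le_mul_dist (h : IsSupConvolution v c f Q) (hB : ∀ p, |v p| ≤ B) (hc : 0 < c)
    (p p' : ℝ × ℝ) :
    f p - f p' ≤ (2 * B + 2 * c * (2 * (2 * B / c + 1) + 1)) * dist p p' := by
  have hB0 : 0 ≤ B := (abs_nonneg _).trans (hB p)
  have h0 : 0 ≤ 2 * B / c := by positivity
  rcases le_total 1 (dist p p') with h1 | h1
  · have e1 := _root_.abs_le.1 (h.abs_le hB hc p)
    have e2 := _root_.abs_le.1 (h.abs_le hB hc p')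
    have e3 : 2 * B * 1 ≤ 2 * B * dist p p' := by gcongr
    have e4 : 0 ≤ 2 * c * (2 * (2 * B / c + 1) + 1) * dist p p' := by positivity
    linarith [e1.2, e2.1]
  · set R := 2 * B / c + 1 with hR
    set d := dist p p' with hd
    have hd0 : 0 ≤ d := dist_nonneg
    have hQR : dist p (Q p) ≤ R := by
      have e1 := h.mul_sq_dist_le hc p
      have e2 : dist (Q p) p ^ 2 ≤ 2 * B / c := by
        rw [le_div_iff₀ hc]
        linarith [(_root_.abs_le.1 (hB p)).1, (_root_.abs_le.1 (hB (Q p))).2]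
      rw [dist_comm]
      nlinarith [sq_nonneg (dist (Q p) p - 1)]
    have e := h.le p' (Q p)
    have key : ∀ a b q : ℝ, |a - b| ≤ d → |a - q| ≤ R →
        (b - q) ^ 2 - (a - q) ^ 2 ≤ (2 * R + 1) * d := by
      intro a b q h2 h3
      have h4 : (b - q) ^ 2 - (a - q) ^ 2 = (b - a) * ((a - q) * 2 + (b - a)) := by ring
      have h5 : |b - a| ≤ d := by rwa [abs_sub_comm]
      have h6 : |(a - q) * 2 + (b - a)| ≤ 2 * R + 1 := by
        refine (abs_add_le _ _).trans ?_
        rw [abs_mul, abs_two]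
        linarith
      rw [h4, mul_comm (2 * R + 1)]
      refine (le_abs_self _).trans ?_
      rw [abs_mul]
      gcongr
    have hfst : ∀ a b : ℝ × ℝ, |a.1 - b.1| ≤ dist a b := fun a b => le_max_left _ _
    have hsnd : ∀ a b : ℝ × ℝ, |a.2 - b.2| ≤ dist a b := fun a b => le_max_right _ _
    have k1 := key p.1 p'.1 (Q p).1 (hfst _ _) ((hfst _ _).trans hQR)
    have k2 := key p.2 p'.2 (Q p).2 (hsnd _ _) ((hsnd _ _).trans hQR)
    have k3 := mul_le_mul_of_nonneg_left (add_le_add k1 k2) hc.le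
    have k4 : 0 ≤ 2 * B * d := by positivity
    rw [h.eq p]
    linarith

theorem exists_lipschitzWith (h : IsSupConvolution v c f Q) (hB : ∀ p, |v p| ≤ B) (hc : 0 < c) :
    ∃ C, LipschitzWith C f :=
  ⟨_, LipschitzWith.of_le_add_mul' _ fun p p' =>
    sub_le_iff_le_add'.1 (h.sub_le_mul_dist hB hc p p')⟩

/-- The sup-convolution and the function it regularizes have matching first order behaviour at `p`
and `Q p`. -/
theorem fderiv_apply (h : IsSupConvolution v c f Q) {p : ℝ × ℝ} (hp : DifferentiableAt ℝ f p)
    (w : ℝ × ℝ) :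
    fderiv ℝ f p w = -2 * c * ((p.1 - (Q p).1) * w.1 + (p.2 - (Q p).2) * w.2) := by
  have h1 : HasDerivAt (fun s : ℝ => f (p + s • w)) (fderiv ℝ f p w) 0 :=
    hp.hasFDerivAt.hasLineDerivAt w
  have h2 : HasDerivAt (fun s : ℝ => f (p + s • w) +
      c * ((p.1 + s * w.1 - (Q p).1) ^ 2 + (p.2 + s * w.2 - (Q p).2) ^ 2))
      (fderiv ℝ f p w + c * (2 * (p.1 - (Q p).1) * w.1 + 2 * (p.2 - (Q p).2) * w.2)) 0 := by
    refine h1.add (HasDerivAt.const_mul c ?_)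
    have e : ∀ a b q : ℝ, HasDerivAt (fun s : ℝ => (a + s * b - q) ^ 2) (2 * (a - q) * b) 0 := by
      intro a b q
      have := ((((hasDerivAt_id (0 : ℝ)).mul_const b).const_add a).sub_const q).pow 2
      simpa [Pi.pow_def] using this
    exact (e _ _ _).add (e _ _ _)
  have h3 : IsLocalMin (fun s : ℝ => f (p + s • w) +
      c * ((p.1 + s * w.1 - (Q p).1) ^ 2 + (p.2 + s * w.2 - (Q p).2) ^ 2)) 0 := by
    refine Eventually.of_forall fun s => ?_
    have e1 := h.le (p + s • w) (Q p)
    have e2 := h.eq p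
    simp only [Prod.fst_add, Prod.snd_add, Prod.smul_fst, Prod.smul_snd, smul_eq_mul] at e1
    simp only [zero_smul, add_zero, zero_mul]
    linarith
  linarith [h3.hasDerivAt_eq_zero h2]

theorem eq_of_hasLineDerivAt (h : IsSupConvolution v c f Q) {p w : ℝ × ℝ} {g : ℝ}
    (hg : HasLineDerivAt ℝ v g (Q p) w) :
    g = -2 * c * ((p.1 - (Q p).1) * w.1 + (p.2 - (Q p).2) * w.2) := by
  have h2 : HasDerivAt (fun s : ℝ => v (Q p + s • w) -
      c * ((p.1 - ((Q p).1 + s * w.1)) ^ 2 + (p.2 - ((Q p).2 + s * w.2)) ^ 2))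
      (g - c * (-(2 * (p.1 - (Q p).1) * w.1) + -(2 * (p.2 - (Q p).2) * w.2))) 0 := by
    refine HasDerivAt.sub hg (HasDerivAt.const_mul c ?_)
    have e : ∀ a b q : ℝ,
        HasDerivAt (fun s : ℝ => (a - (q + s * b)) ^ 2) (-(2 * (a - q) * b)) 0 := by
      intro a b q
      have := ((((hasDerivAt_id (0 : ℝ)).mul_const b).const_add q).const_sub a).pow 2
      simpa [Pi.pow_def] using this
    exact (e _ _ _).add (e _ _ _)
  have h3 : IsLocalMax (fun s : ℝ => v (Q p + s • w) -
      c * ((p.1 - ((Q p).1 + s * w.1)) ^ 2 + (p.2 - ((Q p).2 + s * w.2)) ^ 2)) 0 := by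
    refine Eventually.of_forall fun s => ?_
    have e1 := h.le p (Q p + s • w)
    have e2 := h.eq p
    simp only [Prod.fst_add, Prod.snd_add, Prod.smul_fst, Prod.smul_snd, smul_eq_mul] at e1
    simp only [zero_smul, add_zero, zero_mul]
    linarith
  linarith [h3.hasDerivAt_eq_zero h2]

theorem abs_fderiv_sub_le (h : IsSupConvolution v c f Q) (hc : 0 < c) {p : ℝ × ℝ}
    (hp : DifferentiableAt ℝ f p) {u : ℝ × ℝ → ℝ} {g L : ℝ}
    (hu : |u p - u (Q p)| ≤ L * dist (Q p) p)
    (hg : HasLineDerivAt ℝ v g (Q p) (1, 2 * u (Q p))) :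
    |fderiv ℝ f p (1, 2 * u p) - g| ≤ 4 * L * (v (Q p) - v p) := by
  have hL : 0 ≤ L * dist (Q p) p := (abs_nonneg _).trans hu
  have e : fderiv ℝ f p (1, 2 * u p) - g = -(4 * c * ((p.2 - (Q p).2) * (u p - u (Q p)))) := by
    rw [h.fderiv_apply hp, h.eq_of_hasLineDerivAt hg]
    ring
  have hd : |p.2 - (Q p).2| ≤ dist (Q p) p := by
    rw [dist_comm, Prod.dist_eq]
    exact le_max_right _ _
  rcases eq_or_lt_of_le (dist_nonneg (x := Q p) (y := p)) with h0 | h0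
  · rw [eq_comm, dist_eq_zero] at h0
    rw [e, h0]
    simp
  · have hL0 : 0 ≤ L := nonneg_of_mul_nonneg_left hL h0
    rw [e, abs_neg, abs_mul, abs_of_pos (by positivity : 0 < 4 * c), abs_mul]
    calc 4 * c * (|p.2 - (Q p).2| * |u p - u (Q p)|)
        ≤ 4 * c * (dist (Q p) p * (L * dist (Q p) p)) := by gcongr
      _ = 4 * L * (c * dist (Q p) p ^ 2) := by ring
      _ ≤ _ := by gcongr; exact h.mul_sq_dist_le hc p

theorem tsupport_subset (h : IsSupConvolution v c f Q) (hc : 0 < c) {δ : ℝ}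
    (hδ : ∀ p, dist (Q p) p ≤ δ) : tsupport f ⊆ cthickening δ (tsupport v) := by
  refine closure_minimal (fun p hp => ?_) isClosed_cthickening
  by_contra hpN
  have h1 : v (Q p) = 0 := by
    refine image_eq_zero_of_notMem_tsupport fun hQ => hpN ?_
    exact mem_cthickening_of_dist_le _ _ _ _ hQ (by rw [dist_comm]; exact hδ p)
  have h2 : v p = 0 :=
    image_eq_zero_of_notMem_tsupport fun hQ => hpN (self_subset_cthickening _ hQ)
  exact hp (le_antisymm ((h.le_apply hc p).trans_eq h1) (h2.symm.trans_le (h.self_le p)))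

end IsSupConvolution

theorem HasLineDerivAt.eq_zero_of_notMem_tsupport {v : ℝ × ℝ → ℝ} {p w : ℝ × ℝ} {g : ℝ}
    (hg : HasLineDerivAt ℝ v g p w) (hp : p ∉ tsupport v) : g = 0 := by
  have h0 : HasFDerivAt v (0 : ℝ × ℝ →L[ℝ] ℝ) p :=
    (hasFDerivAt_const (0 : ℝ) p).congr_of_eventuallyEq (notMem_tsupport_iff_eventuallyEq.1 hp)
  simpa using HasDerivAt.unique hg (h0.hasLineDerivAt w)

/-- Remark 4.3: if `∫_D (K v + M (v_x + 2u v_t + 2 v u_t)) = 0` for all smooth `v`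
compactly supported in `D`, then the same holds for every compactly supported continuous
`v` for which the directional derivative `v_x + 2u v_t` (along the field `(1, 2u)`)
exists and is continuous. -/
theorem first_variation_continuous_test_functions
    (D : Set (ℝ × ℝ)) (hD : IsOpen D) (u ut K M : ℝ × ℝ → ℝ)
    (hu : ContDiffOn ℝ 1 u D)
    (hut : ∀ p ∈ D, HasDerivAt (fun y => u (p.1, y)) (ut p) p.2)
    (hutc : ContinuousOn ut D)
    (hK : ContinuousOn K D) (hM : ContinuousOn M D)
    (h : ∀ v : ℝ × ℝ → ℝ, ContDiff ℝ (⊤ : ℕ∞) v → HasCompactSupport v → tsupport v ⊆ D →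
      ∫ p in D, (K p * v p + M p * (fderiv ℝ v p (1, 2 * u p) + 2 * v p * ut p)) = 0) :
    ∀ v g : ℝ × ℝ → ℝ, Continuous v → HasCompactSupport v → tsupport v ⊆ D →
      (∀ p ∈ D, HasLineDerivAt ℝ v (g p) p (1, 2 * u p)) → ContinuousOn g D →
      ∫ p in D, (K p * v p + M p * (g p + 2 * v p * ut p)) = 0 := by
  intro v g hv hvc hvD hg hgc
  obtain ⟨δ, hδ, hδD⟩ := hvc.isCompact.exists_cthickening_subset_open hD hvD
  obtain ⟨B, hB⟩ := hvc.exists_bound_of_continuous hv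
  have hB0 : 0 ≤ B := (norm_nonneg _).trans (hB 0)
  simp only [Real.norm_eq_abs] at hB
  set N := cthickening (δ / 2) (tsupport v)
  set N' := cthickening δ (tsupport v)
  have hN : IsCompact N := hvc.isCompact.cthickening
  have hN' : IsCompact N' := hvc.isCompact.cthickening
  have hNN' : N ⊆ N' := cthickening_mono (by linarith) _
  have hvN : tsupport v ⊆ N := self_subset_cthickening _
  obtain ⟨L, hL⟩ : ∃ L, LipschitzOnWith L u N' := by
    refine LocallyLipschitzOn.exists_lipschitzOnWith_of_compact hN' fun p hp => ?_
    obtain ⟨C, t, ht, hC⟩ :=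
      (hu.contDiffAt (hD.mem_nhds (hδD hp))).exists_lipschitzOnWith
    exact ⟨C, t, mem_nhdsWithin_of_mem_nhds ht, hC⟩
  have hg0 : ∀ p ∈ D, p ∉ tsupport v → g p = 0 := fun p hp hpv =>
    (hg p hp).eq_zero_of_notMem_tsupport hpv
  obtain ⟨G, hG⟩ := hN'.exists_bound_of_continuousOn (hgc.mono hδD)
  simp only [Real.norm_eq_abs] at hG
  choose f Q hfQ using fun n : ℕ => exists_isSupConvolution hv hB (c := (n : ℝ) + 1) (by positivity)
  have hc : ∀ n : ℕ, (0 : ℝ) < n + 1 := fun n => by positivity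
  choose C hC using fun n => (hfQ n).exists_lipschitzWith hB (hc n)
  have hdist : ∀ n p, dist (Q n p) p ≤ √(2 * B * (1 / ((n : ℝ) + 1))) := by
    intro n p
    refine Real.le_sqrt_of_sq_le ?_
    rw [mul_one_div, le_div_iff₀ (hc n)]
    linarith [(hfQ n).mul_sq_dist_le (hc n) p, (abs_le.1 (hB p)).1, (abs_le.1 (hB (Q n p))).2]
  have hlim0 : Tendsto (fun n : ℕ => √(2 * B * (1 / ((n : ℝ) + 1)))) atTop (𝓝 0) := by
    simpa using ((tendsto_one_div_add_atTop_nhds_zero_nat (𝕜 := ℝ)).const_mul (2 * B)).sqrt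
  have hQlim : ∀ p, Tendsto (fun n => Q n p) atTop (𝓝 p) := fun p =>
    tendsto_iff_dist_tendsto_zero.2
      (squeeze_zero (fun _ => dist_nonneg) (fun n => hdist n p) hlim0)
  have hvQ : ∀ p, Tendsto (fun n => v (Q n p)) atTop (𝓝 (v p)) := fun p =>
    (hv.tendsto p).comp (hQlim p)
  have hclose : ∀ᶠ n in atTop, ∀ p, dist (Q n p) p ≤ δ / 2 := by
    filter_upwards [hlim0.eventually (gt_mem_nhds (half_pos hδ))] with n hn p
    exact (hdist n p).trans hn.le
  have hsupp : ∀ᶠ n in atTop, tsupport (f n) ⊆ N := by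
    filter_upwards [hclose] with n hn
    exact (hfQ n).tsupport_subset (hc n) hn
  have hQN : ∀ᶠ n in atTop, ∀ p ∈ N, Q n p ∈ N' := by
    filter_upwards [hclose] with n hn p hp
    have := cthickening_cthickening_subset (half_pos hδ).le (half_pos hδ).le (tsupport v)
      (mem_cthickening_of_dist_le _ _ _ _ hp (hn p))
    rwa [add_halves] at this
  have hzero : ∀ᶠ n in atTop,
      ∫ p in D, (K p * f n p + M p * (fderiv ℝ (f n) p (1, 2 * u p) + 2 * f n p * ut p)) = 0 := by
    filter_upwards [hsupp] with n hn
    exact setIntegral_eq_zero_of_lipschitzWith hD hu.continuousOn hutc hK hM h (hC n)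
      (hN.of_isClosed_subset (isClosed_tsupport _) hn) (hn.trans (hNN'.trans hδD))
  have hfd0 : ∀ᶠ n in atTop, ∀ p ∉ N, fderiv ℝ (f n) p = 0 := by
    filter_upwards [hsupp] with n hn p hp
    exact fderiv_of_notMem_tsupport ℝ (fun hh => hp (hn hh))
  have hdiff : ∀ᵐ p : ℝ × ℝ, ∀ n, DifferentiableAt ℝ (f n) p :=
    ae_all_iff.2 fun n => (hC n).ae_differentiableAt
  have hest : ∀ᶠ n in atTop, ∀ p ∈ N, DifferentiableAt ℝ (f n) p →
      |fderiv ℝ (f n) p (1, 2 * u p) - g (Q n p)| ≤ 4 * L * (v (Q n p) - v p) := by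
    filter_upwards [hQN] with n hn p hp hd
    refine (hfQ n).abs_fderiv_sub_le (hc n) hd ?_ (hg _ (hδD (hn p hp)))
    have := hL.dist_le_mul p (hNN' hp) (Q n p) (hn p hp)
    rwa [dist_comm p, Real.dist_eq] at this
  have hlim := tendsto_setIntegral_of_dominated_on_compact hD hN (hNN'.trans hδD) hK hM hutc
    (f := f) (w := fun n p => fderiv ℝ (f n) p (1, 2 * u p)) (f₀ := v) (w₀ := g)
    (B := max B (4 * L * (2 * B) + max G 0))
    (fun n => (hC n).continuous.aestronglyMeasurable) (fun n => ?_)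
    (Eventually.of_forall fun n p => ((hfQ n).abs_le hB (hc n) p).trans (le_max_left _ _))
    ?_ ?_ ?_ (fun p => ?_) ?_
  · exact tendsto_nhds_unique (hlim.congr' hzero) tendsto_const_nhds
  · have h1 : AEStronglyMeasurable (fun p => ((1 : ℝ), 2 * u p)) (volume.restrict D) :=
      (continuousOn_const.prodMk (continuousOn_const.mul hu.continuousOn)).aestronglyMeasurable
        hD.measurableSet
    exact isBoundedBilinearMap_apply.continuous.comp_aestronglyMeasurable
      ((measurable_fderiv ℝ (f n)).aestronglyMeasurable.prodMk h1)
  · filter_upwards [hest, hfd0, hQN] with n hn hn0 hnQ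
    refine ae_restrict_of_ae ?_
    filter_upwards [hdiff] with p hp
    refine le_trans ?_ (le_max_right _ _)
    by_cases hpN : p ∈ N
    · have e1 := hn p hpN (hp n)
      have e2 := hG _ (hnQ p hpN)
      have e3 := abs_add_le (fderiv ℝ (f n) p (1, 2 * u p) - g (Q n p)) (g (Q n p))
      rw [sub_add_cancel] at e3
      have e4 : 4 * L * (v (Q n p) - v p) ≤ 4 * L * (2 * B) := by
        gcongr
        linarith [(abs_le.1 (hB p)).1, (abs_le.1 (hB (Q n p))).2]
      linarith [le_max_left G 0]
    · rw [hn0 p hpN]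
      rw [zero_apply, abs_zero]
      positivity
  · filter_upwards [hsupp] with n hn p hp
    exact image_eq_zero_of_notMem_tsupport (fun hh => hp (hn hh))
  · filter_upwards [hfd0] with n hn p hp
    simp [hn p hp]
  · exact tendsto_of_tendsto_of_tendsto_of_le_of_le tendsto_const_nhds (hvQ p)
      (fun n => (hfQ n).self_le p) (fun n => (hfQ n).le_apply (hc n) p)
  · filter_upwards [ae_restrict_of_ae hdiff, ae_restrict_mem hD.measurableSet] with p hp hpD
    by_cases hpN : p ∈ N
    · have hgQ : Tendsto (fun n => g (Q n p)) atTop (𝓝 (g p)) :=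
        (hgc.continuousAt (hD.mem_nhds hpD)).tendsto.comp (hQlim p)
      have hsq : Tendsto (fun n => 4 * L * (v (Q n p) - v p)) atTop (𝓝 0) := by
        simpa using ((hvQ p).sub_const (v p)).const_mul (4 * (L : ℝ))
      have hsub : Tendsto (fun n => fderiv ℝ (f n) p (1, 2 * u p) - g (Q n p)) atTop (𝓝 0) := by
        refine squeeze_zero_norm' ?_ hsq
        filter_upwards [hest] with n hn
        exact hn p hpN (hp n)
      simpa using hsub.add hgQ
    · rw [hg0 p hpD fun hh => hpN (hvN hh)]
      refine tendsto_const_nhds.congr' ?_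
      filter_upwards [hfd0] with n hn
      simp [hn p hpN]
end

section
/- Let ρ_j be standard mollifiers on ℝ² and v a compactly supported continuous function on an open set D ⊂ ℝ² such that the directional derivative v_x + 2u·v_t exists and is continuous, where u ∈ C¹(D). Then v_j := ρ_j ∗ v converges to v uniformly and (v_j)_x + 2u·(v_j)_t converges to v_x + 2u·v_t uniformly on compact subsets of D. -/
open MeasureTheory

/-- The squared Euclidean distance on `ℝ × ℝ`. -/
def sqDist (p q : ℝ × ℝ) : ℝ := (p.1 - q.1) ^ 2 + (p.2 - q.2) ^ 2

/-- `w` is the quadratic sup-convolution of `v` with parameter `k`, the supremum at `p` being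
attained at `Q p`. -/
structure IsSupConvolution_s9 (k : ℝ) (v w : ℝ × ℝ → ℝ) (Q : ℝ × ℝ → ℝ × ℝ) : Prop where
  eq : ∀ p, w p = v (Q p) - k * sqDist p (Q p)
  le : ∀ p q, v q - k * sqDist p q ≤ w p

lemma sqDist_nonneg (p q : ℝ × ℝ) : 0 ≤ sqDist p q := by
  unfold sqDist; positivity

lemma dist_sq_le_sqDist (p q : ℝ × ℝ) : dist p q ^ 2 ≤ sqDist p q := by
  rw [Prod.dist_eq, Real.dist_eq, Real.dist_eq, sqDist]
  rcases max_cases |p.1 - q.1| |p.2 - q.2| with ⟨h, -⟩ | ⟨h, -⟩ <;> rw [h, sq_abs] <;> nlinarith [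
    sq_nonneg (p.1 - q.1), sq_nonneg (p.2 - q.2)]

lemma exists_isSupConvolution_s9 {v : ℝ × ℝ → ℝ} (hv : Continuous v) {M : ℝ}
    (hM : ∀ p, |v p| ≤ M) {k : ℝ} (hk : 0 < k) :
    ∃ w Q, IsSupConvolution_s9 k v w Q := by
  have hM0 : 0 ≤ M := (abs_nonneg _).trans (hM 0)
  have key : ∀ p, ∃ q, ∀ q', v q' - k * sqDist p q' ≤ v q - k * sqDist p q := by
    intro p
    refine Continuous.exists_forall_ge' (f := fun q => v q - k * sqDist p q)
      (by unfold sqDist; fun_prop) p ?_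
    filter_upwards [(isCompact_closedBall p (2 * M / k + 1)).compl_mem_cocompact] with q hq
    have hq' : 2 * M / k + 1 < dist p q := by
      simpa [dist_comm] using hq
    have h0 : 0 ≤ 2 * M / k := by positivity
    have h1 : 2 * M / k ≤ sqDist p q := by
      refine le_trans ?_ (dist_sq_le_sqDist p q)
      nlinarith
    have h2 : 2 * M ≤ k * sqDist p q := by
      rw [div_le_iff₀ hk] at h1; linarith
    have h3 : sqDist p p = 0 := by simp [sqDist]
    have := abs_le.1 (hM p)
    have := abs_le.1 (hM q)
    rw [h3]
    linarith
  choose Q hQ using key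
  exact ⟨fun p => v (Q p) - k * sqDist p (Q p), Q, fun _ => rfl, fun p q => hQ p q⟩

namespace IsSupConvolution_s9

variable {k : ℝ} {v w : ℝ × ℝ → ℝ} {Q : ℝ × ℝ → ℝ × ℝ}

lemma self_le_s9 (h : IsSupConvolution_s9 k v w Q) (p : ℝ × ℝ) : v p ≤ w p := by
  simpa [sqDist] using h.le p p

lemma le_apply_s9 (h : IsSupConvolution_s9 k v w Q) (hk : 0 ≤ k) (p : ℝ × ℝ) : w p ≤ v (Q p) := by
  rw [h.eq]
  linarith [mul_nonneg hk (sqDist_nonneg p (Q p))]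

lemma mul_sqDist_le (h : IsSupConvolution_s9 k v w Q) (p : ℝ × ℝ) :
    k * sqDist p (Q p) ≤ v (Q p) - v p := by
  linarith [h.eq p, h.self_le_s9 p]

lemma dist_sq_le (h : IsSupConvolution_s9 k v w Q) (hk : 0 < k) {M : ℝ} (hM : ∀ p, |v p| ≤ M)
    (p : ℝ × ℝ) : dist p (Q p) ^ 2 ≤ 2 * M / k := by
  refine (dist_sq_le_sqDist p (Q p)).trans ?_
  rw [le_div_iff₀ hk]
  linarith [h.mul_sqDist_le p, abs_le.1 (hM p), abs_le.1 (hM (Q p))]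

lemma exists_lipschitzWith_s9 (h : IsSupConvolution_s9 k v w Q) (hk : 0 < k) {M : ℝ}
    (hM : ∀ p, |v p| ≤ M) : ∃ C, LipschitzWith C w := by
  have hM0 : 0 ≤ M := (abs_nonneg _).trans (hM 0)
  set R := √(2 * M / k) with hR
  have hR0 : 0 ≤ R := Real.sqrt_nonneg _
  refine ⟨⟨2 * k * (1 + 2 * R) + 2 * M, by positivity⟩, LipschitzWith.of_le_add_mul _ ?_⟩
  intro p p'
  change w p ≤ w p' + (2 * k * (1 + 2 * R) + 2 * M) * dist p p'
  have hd0 : 0 ≤ dist p p' := dist_nonneg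
  rcases le_or_gt (dist p p') 1 with hd | hd
  · have h1 : |p.1 - p'.1| ≤ dist p p' := by
      rw [Prod.dist_eq, Real.dist_eq]; exact le_max_left _ _
    have h2 : |p.2 - p'.2| ≤ dist p p' := by
      rw [Prod.dist_eq, Real.dist_eq p.2]; exact le_max_right _ _
    have hQ : dist p (Q p) ≤ R := Real.le_sqrt_of_sq_le (h.dist_sq_le hk hM p)
    have h3 : |p.1 - (Q p).1| ≤ R := by
      refine le_trans ?_ hQ
      rw [Prod.dist_eq, Real.dist_eq]; exact le_max_left _ _
    have h4 : |p.2 - (Q p).2| ≤ R := by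
      refine le_trans ?_ hQ
      rw [Prod.dist_eq, Real.dist_eq p.2]; exact le_max_right _ _
    have aux : ∀ a b d : ℝ, |a| ≤ d → d ≤ 1 → |b| ≤ R →
        (b - a) ^ 2 - b ^ 2 ≤ d * (1 + 2 * R) := by
      intro a b d ha hd hb
      have : (b - a) ^ 2 - b ^ 2 ≤ |a| * (|a| + 2 * |b|) := by
        have := neg_abs_le (a * b)
        rw [abs_mul] at this
        nlinarith [sq_abs a]
      refine this.trans ?_
      gcongr
      · exact (abs_nonneg _).trans ha
      · exact ha.trans hd
    have e1 := aux _ _ _ h1 hd h3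
    have e2 := aux _ _ _ h2 hd h4
    have h5 : sqDist p' (Q p) - sqDist p (Q p) ≤ 2 * (dist p p' * (1 + 2 * R)) := by
      unfold sqDist
      rw [show p.1 - (Q p).1 - (p.1 - p'.1) = p'.1 - (Q p).1 by ring] at e1
      rw [show p.2 - (Q p).2 - (p.2 - p'.2) = p'.2 - (Q p).2 by ring] at e2
      linarith
    have h6 := h.le p' (Q p)
    have h7 := h.eq p
    have h8 := mul_le_mul_of_nonneg_left h5 hk.le
    have h9 : 0 ≤ M * dist p p' := by positivity
    nlinarith
  · have h1 := h.le_apply_s9 hk.le p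
    have h2 := h.self_le_s9 p'
    have h3 := abs_le.1 (hM (Q p))
    have h4 := abs_le.1 (hM p')
    have h5 : 0 ≤ 2 * k * (1 + 2 * R) * dist p p' := by positivity
    nlinarith

lemma hasLineDerivAt_eq (h : IsSupConvolution_s9 k v w Q) {p : ℝ × ℝ}
    (hw : DifferentiableAt ℝ w p) {X : ℝ × ℝ} {c : ℝ} (hc : HasLineDerivAt ℝ v c (Q p) X) :
    fderiv ℝ w p X = c := by
  have hwd : HasDerivAt (fun t : ℝ => w (p + t • X)) (fderiv ℝ w p X) 0 :=
    hw.hasFDerivAt.hasLineDerivAt X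
  have hvd : HasDerivAt (fun t : ℝ => v (Q p + t • X)) c 0 := hc
  have hmin : IsLocalMin (fun t : ℝ => w (p + t • X) - v (Q p + t • X)) 0 := by
    refine Filter.Eventually.of_forall fun t => ?_
    have h1 := h.le (p + t • X) (Q p + t • X)
    have h2 : sqDist (p + t • X) (Q p + t • X) = sqDist p (Q p) := by simp [sqDist]
    have h3 := h.eq p
    simp only [zero_smul, add_zero]
    rw [h2] at h1
    linarith
  have := hmin.hasDerivAt_eq_zero (hwd.sub hvd)
  linarith

lemma fderiv_snd_eq (h : IsSupConvolution_s9 k v w Q) {p : ℝ × ℝ}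
    (hw : DifferentiableAt ℝ w p) :
    fderiv ℝ w p (0, 1) = -2 * k * (p.2 - (Q p).2) := by
  have hwd : HasDerivAt (fun t : ℝ => w (p + t • ((0, 1) : ℝ × ℝ))) (fderiv ℝ w p (0, 1)) 0 :=
    hw.hasFDerivAt.hasLineDerivAt (0, 1)
  have hnd : HasDerivAt (fun t : ℝ => k * ((p.1 - (Q p).1) ^ 2 + (p.2 + t - (Q p).2) ^ 2))
      (k * (2 * (p.2 - (Q p).2))) 0 := by
    have h1 : HasDerivAt (fun t : ℝ => p.2 + t - (Q p).2) 1 0 :=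
      ((hasDerivAt_id (0 : ℝ)).const_add p.2).sub_const _
    convert! ((h1.pow 2).const_add ((p.1 - (Q p).1) ^ 2)).const_mul k using 1
    simp
  have hmin : IsLocalMin (fun t : ℝ => w (p + t • ((0, 1) : ℝ × ℝ)) +
      k * ((p.1 - (Q p).1) ^ 2 + (p.2 + t - (Q p).2) ^ 2)) 0 := by
    refine Filter.Eventually.of_forall fun t => ?_
    have h1 := h.le (p + t • ((0, 1) : ℝ × ℝ)) (Q p)
    have h3 := h.eq p
    simp only [sqDist] at h1 h3
    simp only [zero_smul, add_zero]
    simp only [Prod.fst_add, Prod.snd_add, Prod.smul_fst, Prod.smul_snd, smul_eq_mul, mul_zero,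
      mul_one, add_zero] at h1
    linarith
  have := hmin.hasDerivAt_eq_zero (hwd.add hnd)
  linarith

end IsSupConvolution_s9

/-- A continuous function with a continuous derivative along the vector field `(1, 2u)` is
approximated uniformly by Lipschitz functions whose derivatives along the field converge
uniformly on compact sets, at the points of differentiability. -/
lemma exists_lipschitz_approx {D K : Set (ℝ × ℝ)} (hD : IsOpen D) (hK : IsCompact K)
    (hKD : K ⊆ D) {u v g : ℝ × ℝ → ℝ} {L : NNReal} (hu : LipschitzWith L u)
    (hv : Continuous v) (hvsupp : HasCompactSupport v)
    (hg : ∀ p ∈ D, HasLineDerivAt ℝ v (g p) p (1, 2 * u p)) (hgc : ContinuousOn g D)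
    {η : ℝ} (hη : 0 < η) :
    ∃ w C, LipschitzWith C w ∧ (∀ p, |w p - v p| ≤ η) ∧
      ∀ p ∈ K, DifferentiableAt ℝ w p →
        |fderiv ℝ w p (1, 0) + 2 * u p * fderiv ℝ w p (0, 1) - g p| ≤ η := by
  obtain ⟨M, hM⟩ := hvsupp.exists_bound_of_continuous hv
  simp only [Real.norm_eq_abs] at hM
  have hM0 : 0 ≤ M := (abs_nonneg _).trans (hM 0)
  set η' := min η (η / (2 * (4 * L + 1))) with hη'
  have hη'0 : 0 < η' := by positivity
  have hLη : 4 * L * η' ≤ η / 2 := by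
    have h1 : η' ≤ η / (2 * (4 * L + 1)) := min_le_right _ _
    rw [le_div_iff₀ (by positivity)] at h1
    nlinarith
  obtain ⟨δ₁, hδ₁, hvu⟩ := Metric.uniformContinuous_iff.1
    (hv.uniformContinuous_of_tendsto_cocompact
      (by simpa using hvsupp.is_zero_at_infty)) η' hη'0
  obtain ⟨δ₂, hδ₂, hgu⟩ := Metric.mem_uniformity_dist.1
    (hK.uniformContinuousAt_of_continuousAt g
      (fun a ha => hgc.continuousAt (hD.mem_nhds (hKD ha)))
      (Metric.dist_mem_uniformity (half_pos hη)))
  obtain ⟨δ₃, hδ₃, hKδ⟩ := hK.exists_thickening_subset_open hD hKD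
  set δ := min δ₁ (min δ₂ δ₃) with hδ
  have hδ0 : 0 < δ := by positivity
  set k := (2 * M + 1) / δ ^ 2 with hk
  have hk0 : 0 < k := by positivity
  obtain ⟨w, Q, hw⟩ := exists_isSupConvolution_s9 hv hM hk0
  obtain ⟨C, hC⟩ := hw.exists_lipschitzWith_s9 hk0 hM
  have hQ : ∀ p, dist p (Q p) < δ := by
    intro p
    refine lt_of_pow_lt_pow_left₀ 2 hδ0.le ((hw.dist_sq_le hk0 hM p).trans_lt ?_)
    rw [div_lt_iff₀ hk0, hk, mul_div_cancel₀ _ (by positivity)]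
    linarith
  have hvQ : ∀ p, v (Q p) - v p ≤ η' := by
    intro p
    have := hvu ((hQ p).trans_le (min_le_left _ _))
    rw [dist_comm, Real.dist_eq] at this
    exact (le_abs_self _).trans this.le
  refine ⟨w, C, hC, fun p => ?_, fun p hp hdiff => ?_⟩
  · rw [abs_of_nonneg (by linarith [hw.self_le_s9 p])]
    have : η' ≤ η := min_le_left _ _
    linarith [hw.le_apply_s9 hk0.le p, hvQ p]
  · have hQD : Q p ∈ D := by
      refine hKδ (Metric.mem_thickening_iff.2 ⟨p, hp, ?_⟩)
      rw [dist_comm]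
      exact (hQ p).trans_le ((min_le_right _ _).trans (min_le_right _ _))
    have h1 := hw.hasLineDerivAt_eq hdiff (hg _ hQD)
    have h2 := hw.fderiv_snd_eq hdiff
    have h3 : ((1, 2 * u (Q p)) : ℝ × ℝ) = (1, 0) + (2 * u (Q p)) • (0, 1) := by simp
    rw [h3, map_add, map_smul, smul_eq_mul] at h1
    have h4 : |g p - g (Q p)| < η / 2 :=
      hgu ((hQ p).trans_le ((min_le_right _ _).trans (min_le_left _ _))) hp
    have h5 : |2 * (u p - u (Q p)) * fderiv ℝ w p (0, 1)| ≤ η / 2 := by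
      rw [h2, abs_mul, abs_mul, abs_mul, abs_mul]
      have e1 : |u p - u (Q p)| ≤ L * dist p (Q p) := by
        rw [← Real.dist_eq]; exact hu.dist_le_mul _ _
      have e2 : |p.2 - (Q p).2| ≤ dist p (Q p) := by
        rw [Prod.dist_eq, Real.dist_eq p.2]; exact le_max_right _ _
      have e3 : k * dist p (Q p) ^ 2 ≤ η' :=
        (mul_le_mul_of_nonneg_left (dist_sq_le_sqDist _ _) hk0.le).trans
          ((hw.mul_sqDist_le p).trans (hvQ p))
      calc |(2 : ℝ)| * |u p - u (Q p)| * (|(-2 : ℝ)| * |k| * |p.2 - (Q p).2|)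
          ≤ |(2 : ℝ)| * (L * dist p (Q p)) * (|(-2 : ℝ)| * |k| * dist p (Q p)) := by gcongr
        _ = 4 * L * (k * dist p (Q p) ^ 2) := by
          rw [abs_of_pos hk0, abs_neg, abs_two]; ring
        _ ≤ 4 * L * η' := by gcongr
        _ ≤ η / 2 := hLη
    have h6 : fderiv ℝ w p (1, 0) + 2 * u p * fderiv ℝ w p (0, 1) - g p =
        2 * (u p - u (Q p)) * fderiv ℝ w p (0, 1) - (g p - g (Q p)) := by
      rw [← h1]; ring
    rw [h6]
    exact (abs_sub _ _).trans (by linarith)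

/-- Weak form of a pointwise transport equation: if the continuous function `v` has the
continuous derivative `g` along `(1, 2u)` in `D`, then it has it in the sense of distributions. -/
lemma integral_mul_adjoint_eq {D : Set (ℝ × ℝ)} (hD : IsOpen D)
    {u v g φ : ℝ × ℝ → ℝ} {L : NNReal} (hu : LipschitzWith L u) (huc : ContDiff ℝ 1 u)
    (hv : Continuous v) (hvsupp : HasCompactSupport v)
    (hg : ∀ p ∈ D, HasLineDerivAt ℝ v (g p) p (1, 2 * u p)) (hgc : ContinuousOn g D)
    (hφ : ContDiff ℝ 1 φ) (hφc : HasCompactSupport φ) (hφD : tsupport φ ⊆ D) :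
    ∫ q, v q * (fderiv ℝ φ q (1, 0) + 2 * fderiv ℝ (fun x => φ x * u x) q (0, 1)) =
      -∫ q, φ q * g q := by
  set ψ : ℝ × ℝ → ℝ :=
    fun q => fderiv ℝ φ q (1, 0) + 2 * fderiv ℝ (fun x => φ x * u x) q (0, 1) with hψ
  have hφu : ContDiff ℝ 1 (fun x => φ x * u x) := hφ.mul huc
  have hφuc : HasCompactSupport (fun x => φ x * u x) := hφc.mul_right
  have hψcont : Continuous ψ :=
    ((hφ.continuous_fderiv one_ne_zero).clm_apply continuous_const).add
      (continuous_const.mul ((hφu.continuous_fderiv one_ne_zero).clm_apply continuous_const))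
  have hψc : HasCompactSupport ψ :=
    (hφc.fderiv_apply ℝ (1, 0)).add (hφuc.fderiv_apply ℝ (0, 1)).mul_left
  have hφg : Integrable fun q => φ q * g q := by
    refine Continuous.integrable_of_hasCompactSupport ?_ hφc.mul_right
    refine ContinuousOn.continuous_of_tsupport_subset
      (hφ.continuous.continuousOn.mul hgc) hD ((tsupport_mul_subset_left).trans hφD)
  have int_of_cont : ∀ f : ℝ × ℝ → ℝ, Continuous f → Integrable fun q => f q * ψ q :=
    fun f hf => (hf.mul hψcont).integrable_of_hasCompactSupport hψc.mul_left
  set A := ∫ q, |ψ q| with hA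
  set B := ∫ q, |φ q| with hB
  have hA0 : 0 ≤ A := integral_nonneg fun _ => abs_nonneg _
  have hB0 : 0 ≤ B := integral_nonneg fun _ => abs_nonneg _
  have key : ∀ η > 0, |(∫ q, v q * ψ q) + ∫ q, φ q * g q| ≤ η * (A + B) := by
    intro η hη
    obtain ⟨w, C, hwC, hwv, hwg⟩ :=
      exists_lipschitz_approx hD hφc hφD hu hv hvsupp hg hgc hη
    obtain ⟨C₁, hC₁⟩ := hφ.lipschitzWith_of_hasCompactSupport hφc one_ne_zero
    obtain ⟨C₂, hC₂⟩ := hφu.lipschitzWith_of_hasCompactSupport hφuc one_ne_zero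
    have e1 := hwC.integral_lineDeriv_mul_eq (μ := volume) hC₁ hφc (1, 0)
    have e2 := hwC.integral_lineDeriv_mul_eq (μ := volume) hC₂ hφuc (0, 1)
    simp_rw [(hφ.differentiable one_ne_zero).differentiableAt.lineDeriv_eq_fderiv,
      map_neg] at e1
    simp_rw [(hφu.differentiable one_ne_zero).differentiableAt.lineDeriv_eq_fderiv,
      map_neg] at e2
    have i1 : Integrable fun q => lineDeriv ℝ w q (1, 0) * φ q :=
      (hwC.locallyIntegrable_lineDeriv (1, 0)).integrable_smul_right_of_hasCompactSupport
        hφ.continuous hφc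
    have i2 : Integrable fun q => lineDeriv ℝ w q (0, 1) * (φ q * u q) :=
      (hwC.locallyIntegrable_lineDeriv (0, 1)).integrable_smul_right_of_hasCompactSupport
        hφu.continuous hφuc
    have j1 : Integrable fun q => -fderiv ℝ φ q (1, 0) * w q :=
      ((((hφ.continuous_fderiv one_ne_zero).clm_apply continuous_const).neg).mul
        hwC.continuous).integrable_of_hasCompactSupport
        (hφc.fderiv_apply ℝ (1, 0)).neg.mul_right
    have j2 : Integrable fun q => -fderiv ℝ (fun x => φ x * u x) q (0, 1) * w q :=
      ((((hφu.continuous_fderiv one_ne_zero).clm_apply continuous_const).neg).mul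
        hwC.continuous).integrable_of_hasCompactSupport
        (hφuc.fderiv_apply ℝ (0, 1)).neg.mul_right
    set E : ℝ × ℝ → ℝ :=
      fun q => lineDeriv ℝ w q (1, 0) * φ q + 2 * (lineDeriv ℝ w q (0, 1) * (φ q * u q)) with hE
    have iE : Integrable E := i1.add (i2.const_mul 2)
    have hEw : ∫ q, E q = -∫ q, w q * ψ q := by
      rw [hE, integral_add i1 (i2.const_mul 2), integral_const_mul, e1, e2,
        ← integral_const_mul, ← integral_add j1 (j2.const_mul 2), ← integral_neg]
      congr 1 with q
      simp only [hψ]; ring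
    have hsplit : (∫ q, v q * ψ q) + ∫ q, φ q * g q =
        (∫ q, (v q - w q) * ψ q) + ∫ q, (φ q * g q - E q) := by
      rw [integral_sub hφg iE, hEw]
      simp_rw [sub_mul]
      rw [integral_sub (int_of_cont v hv) (int_of_cont w hwC.continuous)]
      ring
    have b1 : |∫ q, (v q - w q) * ψ q| ≤ η * A := by
      rw [hA, ← integral_const_mul]
      rw [← Real.norm_eq_abs]
      refine norm_integral_le_of_norm_le
        ((hψcont.integrable_of_hasCompactSupport hψc).abs.const_mul η)
        (Filter.Eventually.of_forall fun q => ?_)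
      rw [Real.norm_eq_abs, abs_mul]
      gcongr
      rw [abs_sub_comm]
      exact hwv q
    have b2 : |∫ q, (φ q * g q - E q)| ≤ η * B := by
      rw [hB, ← integral_const_mul]
      have hφη : Integrable fun q => η * |φ q| :=
        (hφ.continuous.integrable_of_hasCompactSupport hφc).abs.const_mul η
      rw [← Real.norm_eq_abs]
      refine norm_integral_le_of_norm_le hφη ?_
      filter_upwards [hwC.ae_differentiableAt] with q hq
      rw [Real.norm_eq_abs, hE]
      simp only
      rw [hq.lineDeriv_eq_fderiv, hq.lineDeriv_eq_fderiv]
      by_cases h0 : φ q = 0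
      · simp [h0]
      · have := hwg q (subset_tsupport _ h0) hq
        rw [show φ q * g q - (fderiv ℝ w q (1, 0) * φ q +
          2 * (fderiv ℝ w q (0, 1) * (φ q * u q))) =
          -(fderiv ℝ w q (1, 0) + 2 * u q * fderiv ℝ w q (0, 1) - g q) * φ q by ring,
          abs_mul, abs_neg]
        gcongr
    rw [hsplit]
    exact (abs_add_le _ _).trans (by linarith)
  have hle : |(∫ q, v q * ψ q) + ∫ q, φ q * g q| ≤ 0 := by
    refine le_of_forall_pos_le_add fun ε hε => ?_
    refine (key (ε / (A + B + 1)) (by positivity)).trans ?_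
    rw [zero_add, div_mul_eq_mul_div, div_le_iff₀ (by positivity)]
    nlinarith
  linarith [abs_nonpos_iff.1 hle]

lemma abs_integral_mul_sub_le {φ f : ℝ × ℝ → ℝ} {c ε : ℝ} (hφ0 : ∀ q, 0 ≤ φ q)
    (hφi : ∫ q, φ q = 1) (hφf : Integrable fun q => φ q * f q)
    (hf : ∀ q, φ q ≠ 0 → |f q - c| ≤ ε) : |(∫ q, φ q * f q) - c| ≤ ε := by
  have hφ : Integrable φ := by
    by_contra h
    simp [integral_undef h] at hφi
  have h1 : (∫ q, φ q * f q) - c = ∫ q, φ q * (f q - c) := by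
    simp_rw [mul_sub]
    rw [integral_sub hφf (hφ.mul_const c), integral_mul_const, hφi, one_mul]
  have h2 : ε = ∫ q, φ q * ε := by rw [integral_mul_const, hφi, one_mul]
  rw [h1, h2]
  rw [← Real.norm_eq_abs]
  refine norm_integral_le_of_norm_le (hφ.mul_const ε) (Filter.Eventually.of_forall fun q => ?_)
  rw [Real.norm_eq_abs, abs_mul, abs_of_nonneg (hφ0 q)]
  by_cases h0 : φ q = 0
  · simp [h0]
  · exact mul_le_mul_of_nonneg_left (hf q h0) (hφ0 q)

lemma integral_fderiv_apply_eq_zero {f : ℝ × ℝ → ℝ} (hf : ContDiff ℝ 1 f)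
    (hfc : HasCompactSupport f) (e : ℝ × ℝ) : ∫ q, fderiv ℝ f q e = 0 := by
  obtain ⟨C, hC⟩ := hf.lipschitzWith_of_hasCompactSupport hfc one_ne_zero
  have := (LipschitzWith.const (1 : ℝ)).integral_lineDeriv_mul_eq (μ := volume) hC hfc (-e)
  simp_rw [(hf.differentiable one_ne_zero).differentiableAt.lineDeriv_eq_fderiv] at this
  simpa [lineDeriv] using this.symm

lemma fderiv_convolution_apply {κ v : ℝ × ℝ → ℝ} (hκ : ContDiff ℝ 1 κ)
    (hκc : HasCompactSupport κ) (hv : Continuous v) (p X : ℝ × ℝ) :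
    fderiv ℝ (fun x => ∫ q, κ q * v (x - q)) p X = ∫ q, v q * fderiv ℝ κ (p - q) X := by
  have h1 : (fun x => ∫ q, κ q * v (x - q)) =
      convolution v κ (ContinuousLinearMap.mul ℝ ℝ) volume := by
    ext x
    rw [convolution_mul_swap]
    simp_rw [mul_comm]
  rw [h1, (hκc.hasFDerivAt_convolution_right _ hv.locallyIntegrable hκ p).fderiv,
    convolution_precompR_apply _ hv.locallyIntegrable (hκc.fderiv ℝ)
      (hκ.continuous_fderiv one_ne_zero)]
  rfl

/-- Friedrichs commutator estimate for mollification by a kernel supported in a ball of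
radius `r`. -/
lemma abs_fderiv_convolution_sub_le {D : Set (ℝ × ℝ)} (hD : IsOpen D)
    {u v g κ : ℝ × ℝ → ℝ} {L : NNReal} (hu : LipschitzWith L u) (huc : ContDiff ℝ 1 u)
    (hv : Continuous v) (hvsupp : HasCompactSupport v)
    (hg : ∀ p ∈ D, HasLineDerivAt ℝ v (g p) p (1, 2 * u p)) (hgc : ContinuousOn g D)
    (hκ : ContDiff ℝ 1 κ) (hκ0 : ∀ q, 0 ≤ κ q) (hκi : ∫ q, κ q = 1) {r : ℝ}
    (hκr : tsupport κ ⊆ Metric.closedBall 0 r) {p : ℝ × ℝ} (hp : Metric.closedBall p r ⊆ D)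
    {ε ω : ℝ} (hε : ∀ q, dist q p ≤ r → |g q - g p| ≤ ε)
    (hω : ∀ q, dist q p ≤ r → |v q - v p| ≤ ω) :
    |fderiv ℝ (fun x => ∫ q, κ q * v (x - q)) p (1, 2 * u p) - g p| ≤
      ε + 2 * (ω * (L * (r * (∫ q, |fderiv ℝ κ q (0, 1)|) + 1))) := by
  have hκc : HasCompactSupport κ :=
    (isCompact_closedBall (0 : ℝ × ℝ) r).of_isClosed_subset (isClosed_tsupport _) hκr
  set φ : ℝ × ℝ → ℝ := fun q => κ (p - q) with hφdef
  have hφ : ContDiff ℝ 1 φ := hκ.comp (contDiff_const.sub contDiff_id)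
  have hφsupp : Function.support φ ⊆ Metric.closedBall p r := by
    intro q hq
    have := hκr (subset_tsupport _ hq)
    rw [mem_closedBall_zero_iff] at this
    rwa [Metric.mem_closedBall, dist_comm, dist_eq_norm]
  have hφts : tsupport φ ⊆ Metric.closedBall p r :=
    closure_minimal hφsupp Metric.isClosed_closedBall
  have hφc : HasCompactSupport φ :=
    (isCompact_closedBall p r).of_isClosed_subset (isClosed_tsupport _) hφts
  have hφi : ∫ q, φ q = 1 := by rw [← hκi]; exact integral_sub_left_eq_self κ volume p
  have hφfd : ∀ q X, fderiv ℝ φ q X = -fderiv ℝ κ (p - q) X := by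
    intro q X
    have h1 : HasFDerivAt (fun q => p - q) (-ContinuousLinearMap.id ℝ (ℝ × ℝ)) q :=
      (hasFDerivAt_id q).const_sub p
    have h2 := ((hκ.differentiable one_ne_zero).differentiableAt (x := p - q)).hasFDerivAt.comp q h1
    rw [hφdef, show (fun q => κ (p - q)) = κ ∘ (fun q => p - q) from rfl, h2.fderiv]
    simp
  have hφg : Integrable fun q => φ q * g q := by
    refine Continuous.integrable_of_hasCompactSupport ?_ hφc.mul_right
    exact ContinuousOn.continuous_of_tsupport_subset
      (hφ.continuous.continuousOn.mul hgc) hD (tsupport_mul_subset_left.trans (hφts.trans hp))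
  set θ : ℝ × ℝ → ℝ := fun x => φ x * (u x - u p) with hθdef
  have hθ : ContDiff ℝ 1 θ := hφ.mul (huc.sub contDiff_const)
  have hθc : HasCompactSupport θ := hφc.mul_right
  have hθcont : Continuous fun q => fderiv ℝ θ q (0, 1) :=
    (hθ.continuous_fderiv one_ne_zero).clm_apply continuous_const
  have hθi : Integrable fun q => fderiv ℝ θ q (0, 1) :=
    hθcont.integrable_of_hasCompactSupport (hθc.fderiv_apply ℝ (0, 1))
  have hθvi : Integrable fun q => v q * fderiv ℝ θ q (0, 1) :=
    (hv.mul hθcont).integrable_of_hasCompactSupport (hθc.fderiv_apply ℝ (0, 1)).mul_left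
  have hθfd : ∀ q, fderiv ℝ θ q (0, 1) =
      fderiv ℝ φ q (0, 1) * (u q - u p) + φ q * fderiv ℝ u q (0, 1) := by
    intro q
    rw [hθdef, fderiv_fun_mul (hφ.differentiable one_ne_zero q)
      ((huc.differentiable one_ne_zero q).sub_const _), fderiv_sub_const]
    simp; ring
  have hφufd : ∀ q, fderiv ℝ (fun x => φ x * u x) q (0, 1) =
      fderiv ℝ φ q (0, 1) * u q + φ q * fderiv ℝ u q (0, 1) := by
    intro q
    rw [fderiv_fun_mul (hφ.differentiable one_ne_zero q) (huc.differentiable one_ne_zero q)]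
    simp; ring
  have hweak := integral_mul_adjoint_eq hD hu huc hv hvsupp hg hgc hφ hφc (hφts.trans hp)
  have hvφ : Continuous fun q => fderiv ℝ φ q (1, 2 * u p) :=
    (hφ.continuous_fderiv one_ne_zero).clm_apply continuous_const
  have hvφi : Integrable fun q => v q * fderiv ℝ φ q (1, 2 * u p) :=
    (hv.mul hvφ).integrable_of_hasCompactSupport (hφc.fderiv_apply ℝ _).mul_left
  have hid : fderiv ℝ (fun x => ∫ q, κ q * v (x - q)) p (1, 2 * u p) =
      (∫ q, φ q * g q) + 2 * ∫ q, (v q - v p) * fderiv ℝ θ q (0, 1) := by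
    have h1 : ∫ q, (v q - v p) * fderiv ℝ θ q (0, 1) = ∫ q, v q * fderiv ℝ θ q (0, 1) := by
      simp_rw [sub_mul]
      rw [integral_sub hθvi (hθi.const_mul _), integral_const_mul,
        integral_fderiv_apply_eq_zero hθ hθc, mul_zero, sub_zero]
    have h2 : ∫ q, v q * (fderiv ℝ φ q (1, 0) + 2 * fderiv ℝ (fun x => φ x * u x) q (0, 1)) =
        (∫ q, v q * fderiv ℝ φ q (1, 2 * u p)) + 2 * ∫ q, v q * fderiv ℝ θ q (0, 1) := by
      rw [← integral_const_mul, ← integral_add hvφi (hθvi.const_mul 2)]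
      congr 1 with q
      rw [hθfd, hφufd, show ((1, 2 * u p) : ℝ × ℝ) = (1, 0) + (2 * u p) • (0, 1) by simp,
        map_add, map_smul, smul_eq_mul]
      ring
    have h3 : fderiv ℝ (fun x => ∫ q, κ q * v (x - q)) p (1, 2 * u p) =
        -∫ q, v q * fderiv ℝ φ q (1, 2 * u p) := by
      rw [fderiv_convolution_apply hκ hκc hv, ← integral_neg]
      congr 1 with q
      rw [hφfd]; ring
    rw [h1, h3]
    linarith
  have hmain : |(∫ q, φ q * g q) - g p| ≤ ε :=
    abs_integral_mul_sub_le (fun q => hκ0 _) hφi hφg fun q hq => hε q (hφsupp hq)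
  have hω0 : 0 ≤ ω := by
    by_contra hneg
    have hr : ¬ 0 ≤ r := fun hr => hneg ((abs_nonneg _).trans (hω p (by simpa using hr)))
    have : φ = 0 := by
      ext q
      by_contra hq
      exact hr (dist_nonneg.trans (hφsupp hq))
    simp [this] at hφi
  have hdκ : Integrable fun q => |fderiv ℝ κ q (0, 1)| :=
    (((hκ.continuous_fderiv one_ne_zero).clm_apply
      continuous_const).integrable_of_hasCompactSupport (hκc.fderiv_apply ℝ (0, 1))).abs
  have hφint : Integrable φ := hφ.continuous.integrable_of_hasCompactSupport hφc
  have hbound : |∫ q, (v q - v p) * fderiv ℝ θ q (0, 1)| ≤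
      ω * (L * (r * (∫ q, |fderiv ℝ κ q (0, 1)|) + 1)) := by
    have hrhs : ω * (L * (r * (∫ q, |fderiv ℝ κ q (0, 1)|) + 1)) =
        ∫ q, ω * (L * (r * |fderiv ℝ κ (p - q) (0, 1)| + φ q)) := by
      rw [integral_const_mul, integral_const_mul,
        integral_add ((hdκ.comp_sub_left p).const_mul r) hφint, integral_const_mul, hφi,
        integral_sub_left_eq_self (fun q => |fderiv ℝ κ q (0, 1)|) volume p]
    have hbint : Integrable fun q => ω * (L * (r * |fderiv ℝ κ (p - q) (0, 1)| + φ q)) :=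
      ((((hdκ.comp_sub_left p).const_mul r).add hφint).const_mul _).const_mul _
    rw [hrhs]
    rw [← Real.norm_eq_abs]
    refine norm_integral_le_of_norm_le hbint
      (Filter.Eventually.of_forall fun q => ?_)
    rw [Real.norm_eq_abs, abs_mul]
    by_cases hq : q ∈ tsupport φ
    · have hqr : dist q p ≤ r := hφts hq
      have hr0 : 0 ≤ r := dist_nonneg.trans hqr
      refine mul_le_mul (hω q hqr) ?_ (abs_nonneg _) hω0
      rw [hθfd, hφfd]
      have c1 : |u q - u p| ≤ L * r := by
        rw [← Real.dist_eq]
        exact (hu.dist_le_mul _ _).trans (by gcongr)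
      have c2 : |fderiv ℝ u q (0, 1)| ≤ L := by
        rw [← Real.norm_eq_abs]
        refine ((fderiv ℝ u q).le_opNorm _).trans ?_
        have : ‖((0, 1) : ℝ × ℝ)‖ = 1 := by simp [Prod.norm_def]
        rw [this, mul_one]
        exact norm_fderiv_le_of_lipschitz ℝ hu
      calc |-fderiv ℝ κ (p - q) (0, 1) * (u q - u p) + φ q * fderiv ℝ u q (0, 1)|
          ≤ |fderiv ℝ κ (p - q) (0, 1)| * |u q - u p| + φ q * |fderiv ℝ u q (0, 1)| := by
            refine (abs_add_le _ _).trans ?_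
            rw [abs_mul, abs_mul, abs_neg, abs_of_nonneg (show 0 ≤ φ q from hκ0 _)]
        _ ≤ |fderiv ℝ κ (p - q) (0, 1)| * (L * r) + φ q * L := by
            gcongr
            exact hκ0 _
        _ = _ := by ring
    · have hz : fderiv ℝ θ q (0, 1) = 0 := by
        have hnt : q ∉ tsupport θ := fun h => hq (tsupport_mul_subset_left h)
        have : fderiv ℝ θ q = 0 := by
          by_contra hne
          exact hnt (support_fderiv_subset ℝ hne)
        simp [this]
      have hz' : fderiv ℝ κ (p - q) (0, 1) = 0 := by
        have : fderiv ℝ φ q = 0 := by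
          by_contra hne
          exact hq (support_fderiv_subset ℝ hne)
        have h := hφfd q (0, 1)
        rw [this] at h
        simpa using h.symm
      rw [hz, hz', abs_zero, mul_zero, mul_zero, zero_add]
      exact mul_nonneg hω0 (mul_nonneg L.2 (hκ0 _))
  rw [hid, show (∫ q, φ q * g q) + 2 * (∫ q, (v q - v p) * fderiv ℝ θ q (0, 1)) - g p =
    ((∫ q, φ q * g q) - g p) + 2 * ∫ q, (v q - v p) * fderiv ℝ θ q (0, 1) by ring]
  refine (abs_add_le _ _).trans ?_
  rw [abs_mul, abs_two]
  gcongr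

section Scaling

variable {ρ : ℝ × ℝ → ℝ} {c : ℝ}

lemma tsupport_sq_mul_comp_smul_subset (hρ : tsupport ρ ⊆ Metric.closedBall 0 1) (hc : 0 < c) :
    tsupport (fun q => c ^ 2 * ρ (c • q)) ⊆ Metric.closedBall 0 (1 / c) := by
  refine closure_minimal (fun q hq => ?_) Metric.isClosed_closedBall
  have h := hρ (subset_tsupport _ (right_ne_zero_of_mul hq))
  rw [mem_closedBall_zero_iff, norm_smul, Real.norm_eq_abs, abs_of_pos hc] at h
  rw [mem_closedBall_zero_iff, le_div_iff₀ hc]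
  linarith

lemma integral_sq_mul_comp_smul (f : ℝ × ℝ → ℝ) (hc : 0 < c) :
    ∫ q, c ^ 2 * f (c • q) = ∫ q, f q := by
  rw [integral_const_mul, Measure.integral_comp_smul]
  simp only [Module.finrank_prod, Module.finrank_self, smul_eq_mul]
  rw [abs_of_pos (by positivity), ← mul_assoc, mul_inv_cancel₀ (by positivity), one_mul]

lemma integral_abs_fderiv_sq_mul_comp_smul (hρ : Differentiable ℝ ρ) (hc : 0 < c) (e : ℝ × ℝ) :
    1 / c * ∫ q, |fderiv ℝ (fun x => c ^ 2 * ρ (c • x)) q e| = ∫ q, |fderiv ℝ ρ q e| := by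
  rw [← integral_sq_mul_comp_smul (fun q => |fderiv ℝ ρ q e|) hc, ← integral_const_mul]
  congr 1 with q
  have h1 : HasFDerivAt (fun x : ℝ × ℝ => c • x) (c • ContinuousLinearMap.id ℝ (ℝ × ℝ)) q :=
    (hasFDerivAt_id q).const_smul c
  have h2 : HasFDerivAt (fun x => c ^ 2 * ρ (c • x)) _ q :=
    ((hρ (c • q)).hasFDerivAt.comp q h1).const_mul (c ^ 2)
  rw [h2.fderiv]
  simp only [smul_apply, ContinuousLinearMap.comp_apply,
    ContinuousLinearMap.id_apply, map_smul, smul_eq_mul, abs_mul, abs_of_pos hc,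
    abs_of_pos (pow_pos hc 2)]
  field_simp

end Scaling

/-- A `C¹` function on an open set coincides, near a given compact subset, with a compactly
supported `C¹` function on the whole space. -/
lemma exists_contDiff_eqOn_compact {D C : Set (ℝ × ℝ)} (hD : IsOpen D) (hC : IsCompact C)
    (hCD : C ⊆ D) {u : ℝ × ℝ → ℝ} (hu : ContDiffOn ℝ 1 u D) :
    ∃ (U : Set (ℝ × ℝ)) (w : ℝ × ℝ → ℝ), IsOpen U ∧ C ⊆ U ∧ U ⊆ D ∧ Set.EqOn w u U ∧
      ContDiff ℝ 1 w ∧ HasCompactSupport w := by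
  obtain ⟨K₁, hK₁, hCK₁, hK₁D⟩ := exists_compact_between hC hD hCD
  obtain ⟨K₂, hK₂, hK₁₂, hK₂D⟩ := exists_compact_between hK₁ hD hK₁D
  obtain ⟨χ, hχ, -, hχ0, hχ1⟩ := exists_contMDiff_zero_iff_one_iff_of_isClosed
    (modelWithCornersSelf ℝ (ℝ × ℝ)) (n := 1) (isOpen_interior (s := K₂)).isClosed_compl
    hK₁.isClosed (Set.disjoint_compl_left_iff_subset.2 hK₁₂)
  have hχ' : ContDiff ℝ 1 χ := hχ.contDiff
  have hsupp : tsupport χ ⊆ K₂ := by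
    refine closure_minimal (fun q hq => interior_subset (s := K₂) ?_) hK₂.isClosed
    by_contra hn
    exact hq ((hχ0 q).1 hn)
  have hχc : HasCompactSupport χ := hK₂.of_isClosed_subset (isClosed_tsupport _) hsupp
  refine ⟨interior K₁, fun q => χ q * u q, isOpen_interior, hCK₁, interior_subset.trans hK₁D,
    fun q hq => ?_, ?_, hχc.mul_right⟩
  · simp [(hχ1 q).1 (interior_subset hq)]
  · rw [contDiff_iff_contDiffAt]
    intro q
    by_cases hq : q ∈ tsupport χ
    · exact hχ'.contDiffAt.mul (hu.contDiffAt (hD.mem_nhds (hK₂D (hsupp hq))))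
    · refine (contDiffAt_const (c := (0 : ℝ))).congr_of_eventuallyEq ?_
      filter_upwards [(isClosed_tsupport χ).isOpen_compl.mem_nhds hq] with x hx
      simp [image_eq_zero_of_notMem_tsupport hx]

/-- Mollification step of Remark 4.3: for standard mollifiers `ρ_j(x) = j² ρ(j x)` on `ℝ²`
and a compactly supported continuous `v` on an open `D ⊆ ℝ²` whose directional derivative
`v_x + 2 u v_t` (along the vector field `(1, 2u)`, `u ∈ C¹(D)`) exists and is continuous,
the mollifications `v_j = ρ_j ∗ v` converge to `v` uniformly, and
`(v_j)_x + 2u (v_j)_t` converges to `v_x + 2u v_t` uniformly on compact subsets of `D`. -/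
theorem mollifier_convergence
    (D : Set (ℝ × ℝ)) (hD : IsOpen D) (u v g : ℝ × ℝ → ℝ)
    (hu : ContDiffOn ℝ 1 u D)
    (hv : Continuous v) (hvsupp : HasCompactSupport v) (hvD : tsupport v ⊆ D)
    (hg : ∀ p ∈ D, HasLineDerivAt ℝ v (g p) p (1, 2 * u p)) (hgc : ContinuousOn g D)
    (ρ : ℝ × ℝ → ℝ) (hρ : ContDiff ℝ (⊤ : ℕ∞) ρ) (hρ0 : ∀ p, 0 ≤ ρ p)
    (hρsupp : tsupport ρ ⊆ Metric.closedBall 0 1) (hρint : ∫ p, ρ p = 1)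
    (vj : ℕ → ℝ × ℝ → ℝ)
    (hvj : ∀ j : ℕ, ∀ p, vj j p = ∫ q, ((j : ℝ) ^ 2 * ρ ((j : ℝ) • q)) * v (p - q)) :
    TendstoUniformly vj v Filter.atTop ∧
    ∀ C : Set (ℝ × ℝ), IsCompact C → C ⊆ D →
      TendstoUniformlyOn (fun j p => fderiv ℝ (vj j) p (1, 2 * u p)) g Filter.atTop C := by
  have hvuc : UniformContinuous v :=
    hv.uniformContinuous_of_tendsto_cocompact (by simpa using hvsupp.is_zero_at_infty)
  have hsmall : ∀ δ > (0 : ℝ), ∀ᶠ j : ℕ in Filter.atTop, 0 < (j : ℝ) ∧ 1 / (j : ℝ) < δ := by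
    intro δ hδ
    filter_upwards [Filter.eventually_gt_atTop 0,
      tendsto_one_div_atTop_nhds_zero_nat.eventually_lt_const hδ] with j hj hj'
    exact ⟨by exact_mod_cast hj, hj'⟩
  have hκ : ∀ c : ℝ, ContDiff ℝ 1 fun q => c ^ 2 * ρ (c • q) := fun c =>
    contDiff_const.mul ((hρ.of_le (by exact_mod_cast le_top)).comp (contDiff_const_smul c))
  have hκ0 : ∀ (c : ℝ) q, 0 ≤ c ^ 2 * ρ (c • q) := fun c q => mul_nonneg (sq_nonneg c) (hρ0 _)
  have hκi : ∀ c : ℝ, 0 < c → ∫ q, c ^ 2 * ρ (c • q) = 1 := fun c hc =>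
    (integral_sq_mul_comp_smul ρ hc).trans hρint
  constructor
  · rw [Metric.tendstoUniformly_iff]
    intro ε hε
    obtain ⟨δ, hδ, hvδ⟩ := Metric.uniformContinuous_iff.1 hvuc (ε / 2) (half_pos hε)
    filter_upwards [hsmall δ hδ] with j hj p
    have hts := tsupport_sq_mul_comp_smul_subset hρsupp hj.1
    rw [dist_comm, Real.dist_eq, hvj]
    refine (abs_integral_mul_sub_le (hκ0 j) (hκi j hj.1) ?_ fun q hq => ?_).trans_lt
      (half_lt_self hε)
    · refine ((hκ j).continuous.mul (by fun_prop)).integrable_of_hasCompactSupport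
        (HasCompactSupport.mul_right ?_)
      exact (isCompact_closedBall _ _).of_isClosed_subset (isClosed_tsupport _) hts
    · rw [← Real.dist_eq]
      refine (hvδ ?_).le
      have := hts (subset_tsupport _ hq)
      rw [mem_closedBall_zero_iff] at this
      rw [dist_eq_norm, sub_sub_cancel_left, norm_neg]
      exact this.trans_lt hj.2
  · intro C hC hCD
    obtain ⟨U, w, hU, hCU, hUD, hwu, hw, hwc⟩ := exists_contDiff_eqOn_compact hD hC hCD hu
    obtain ⟨L, hL⟩ := hw.lipschitzWith_of_hasCompactSupport hwc one_ne_zero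
    have hgU : ∀ p ∈ U, HasLineDerivAt ℝ v (g p) p (1, 2 * w p) := by
      intro p hp
      rw [hwu hp]
      exact hg p (hUD hp)
    rw [Metric.tendstoUniformlyOn_iff]
    intro ε hε
    set A := ∫ q, |fderiv ℝ ρ q (0, 1)| with hA
    have hA0 : 0 ≤ A := integral_nonneg fun _ => abs_nonneg _
    set ω := ε / (8 * (L * (A + 1) + 1)) with hω
    have hω0 : 0 < ω := by positivity
    have hωε : 2 * (ω * (L * (A + 1))) ≤ ε / 4 := by
      have : ω * (8 * (L * (A + 1) + 1)) = ε := div_mul_cancel₀ _ (by positivity)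
      nlinarith
    obtain ⟨δ₁, hδ₁, hvδ⟩ := Metric.uniformContinuous_iff.1 hvuc ω hω0
    obtain ⟨δ₂, hδ₂, hgδ⟩ := Metric.mem_uniformity_dist.1
      (hC.uniformContinuousAt_of_continuousAt g
        (fun a ha => hgc.continuousAt (hD.mem_nhds (hCD ha)))
        (Metric.dist_mem_uniformity (half_pos hε)))
    obtain ⟨δ₃, hδ₃, hCδ⟩ := hC.exists_thickening_subset_open hU hCU
    filter_upwards [hsmall _ (lt_min hδ₁ (lt_min hδ₂ hδ₃))] with j hj p hp
    obtain ⟨hj0, hjδ⟩ := hj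
    rw [lt_min_iff, lt_min_iff] at hjδ
    have hball : Metric.closedBall p (1 / (j : ℝ)) ⊆ U := fun q hq =>
      hCδ (Metric.mem_thickening_iff.2 ⟨p, hp, (Metric.mem_closedBall.1 hq).trans_lt hjδ.2.2⟩)
    have hest := abs_fderiv_convolution_sub_le hU hL hw hv hvsupp hgU (hgc.mono hUD)
      (hκ j) (hκ0 j) (hκi j hj0) (tsupport_sq_mul_comp_smul_subset hρsupp hj0) hball
      (ε := ε / 2) (ω := ω)
      (fun q hq => by
        rw [← Real.dist_eq, dist_comm]
        exact (hgδ (by rw [dist_comm]; exact hq.trans_lt hjδ.2.1) hp).le)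
      (fun q hq => (hvδ (hq.trans_lt hjδ.1)).le)
    rw [integral_abs_fderiv_sq_mul_comp_smul (hρ.differentiable (by simp)) hj0, ← hA,
      hwu (hCU hp), ← funext (hvj j)] at hest
    rw [dist_comm, Real.dist_eq]
    linarith
end
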